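/- (Lemma 1) Suppose the nonzero constants k_e, k_a, k_u all have the same sign. Then along any trajectory of the mechanical system with inner-loop control u(t) := τ(t) − ∇V_a(q_a(t)), the function H₁(q_u, q̇) := k_e [ k_a H_a(q_u, q̇) + k_u H_u(q_u, q̇_u) ] is bounded from below and satisfies d/dt H₁(q_u(t), q̇(t)) = k_e u(t)ᵀ y_d(t); consequently there exists β₁ ∈ ℝ (depending on the initial condition) such that ∫₀ᵗ k_e u(s)ᵀ y_d(s) ds ≥ β₁ for all t ≥ 0, i.e. the operator k_e u ↦ y_d is passive. -/

import Mathlib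

open Matrix Set Filter

noncomputable section

/-- Componentwise gradient of a scalar function on `Fin k → ℝ`. -/
def grad {k : ℕ} (f : (Fin k → ℝ) → ℝ) (x : Fin k → ℝ) : Fin k → ℝ :=
  fun i => fderiv ℝ f x (Pi.single i 1)

/-- The block inertia matrix `M(q_u) = [[m_uu, m_auᵀ], [m_au, m_aa]]`. -/
def Mblk {s m : ℕ} (muu : (Fin s → ℝ) → Matrix (Fin s) (Fin s) ℝ)
    (mau : (Fin s → ℝ) → Matrix (Fin m) (Fin s) ℝ)
    (maa : Matrix (Fin m) (Fin m) ℝ) (qu : Fin s → ℝ) :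
    Matrix (Fin s ⊕ Fin m) (Fin s ⊕ Fin m) ℝ :=
  Matrix.fromBlocks (muu qu) (mau qu)ᵀ (mau qu) maa

/-- The Jacobian `J(q, v)` (w.r.t. `q`) of the map `q ↦ M(q_u) v`. -/
def Jmat {s m : ℕ} (muu : (Fin s → ℝ) → Matrix (Fin s) (Fin s) ℝ)
    (mau : (Fin s → ℝ) → Matrix (Fin m) (Fin s) ℝ)
    (maa : Matrix (Fin m) (Fin m) ℝ)
    (q v : (Fin s ⊕ Fin m) → ℝ) :
    Matrix (Fin s ⊕ Fin m) (Fin s ⊕ Fin m) ℝ :=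
  fun i j =>
    fderiv ℝ (fun p : (Fin s ⊕ Fin m) → ℝ =>
      (Mblk muu mau maa (p ∘ Sum.inl) *ᵥ v) i) q (Pi.single j 1)

/-- The Coriolis force vector `C(q, q̇) q̇ = [J(q,q̇) − ½ J(q,q̇)ᵀ] q̇`. -/
def Cvec {s m : ℕ} (muu : (Fin s → ℝ) → Matrix (Fin s) (Fin s) ℝ)
    (mau : (Fin s → ℝ) → Matrix (Fin m) (Fin s) ℝ)
    (maa : Matrix (Fin m) (Fin m) ℝ)
    (q v : (Fin s ⊕ Fin m) → ℝ) : (Fin s ⊕ Fin m) → ℝ :=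
  (Jmat muu mau maa q v - (1/2 : ℝ) • (Jmat muu mau maa q v)ᵀ) *ᵥ v

/-- The Schur complement `m_uu^s(q_u) = m_uu − m_auᵀ m_aa⁻¹ m_au`. -/
def muuS {s m : ℕ} (muu : (Fin s → ℝ) → Matrix (Fin s) (Fin s) ℝ)
    (mau : (Fin s → ℝ) → Matrix (Fin m) (Fin s) ℝ)
    (maa : Matrix (Fin m) (Fin m) ℝ) (qu : Fin s → ℝ) : Matrix (Fin s) (Fin s) ℝ :=
  muu qu - (mau qu)ᵀ * maa⁻¹ * mau qu

/-- `M_a(q_u) = [[m_auᵀ m_aa⁻¹ m_au, m_auᵀ], [m_au, m_aa]]`. -/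
def MaMat {s m : ℕ} (mau : (Fin s → ℝ) → Matrix (Fin m) (Fin s) ℝ)
    (maa : Matrix (Fin m) (Fin m) ℝ) (qu : Fin s → ℝ) :
    Matrix (Fin s ⊕ Fin m) (Fin s ⊕ Fin m) ℝ :=
  Matrix.fromBlocks ((mau qu)ᵀ * maa⁻¹ * mau qu) (mau qu)ᵀ (mau qu) maa

/-- Storage function `H_u(q_u, q̇_u) = ½ q̇_uᵀ m_uu^s(q_u) q̇_u + V_u(q_u)`. -/
def Hu {s m : ℕ} (muu : (Fin s → ℝ) → Matrix (Fin s) (Fin s) ℝ)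
    (mau : (Fin s → ℝ) → Matrix (Fin m) (Fin s) ℝ)
    (maa : Matrix (Fin m) (Fin m) ℝ) (Vu : (Fin s → ℝ) → ℝ)
    (qu vu : Fin s → ℝ) : ℝ :=
  (1/2 : ℝ) * (vu ⬝ᵥ muuS muu mau maa qu *ᵥ vu) + Vu qu

/-- Storage function `H_a(q_u, q̇) = ½ q̇ᵀ M_a(q_u) q̇`. -/
def Ha {s m : ℕ} (mau : (Fin s → ℝ) → Matrix (Fin m) (Fin s) ℝ)
    (maa : Matrix (Fin m) (Fin m) ℝ) (qu : Fin s → ℝ)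
    (qdot : (Fin s ⊕ Fin m) → ℝ) : ℝ :=
  (1/2 : ℝ) * (qdot ⬝ᵥ MaMat mau maa qu *ᵥ qdot)

/-- Passive output `y_u = −m_aa⁻¹ m_au(q_u) q̇_u`. -/
def yU {s m : ℕ} (mau : (Fin s → ℝ) → Matrix (Fin m) (Fin s) ℝ)
    (maa : Matrix (Fin m) (Fin m) ℝ) (qu vu : Fin s → ℝ) : Fin m → ℝ :=
  -(maa⁻¹ *ᵥ (mau qu *ᵥ vu))

/-- Passive output `y_a = m_aa⁻¹ m_au(q_u) q̇_u + q̇_a`. -/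
def yA {s m : ℕ} (mau : (Fin s → ℝ) → Matrix (Fin m) (Fin s) ℝ)
    (maa : Matrix (Fin m) (Fin m) ℝ) (qu vu : Fin s → ℝ) (va : Fin m → ℝ) : Fin m → ℝ :=
  maa⁻¹ *ᵥ (mau qu *ᵥ vu) + va

/-- The signal `y_d = k_a y_a + k_u y_u` along a trajectory. -/
def ydSig {s m : ℕ} (mau : (Fin s → ℝ) → Matrix (Fin m) (Fin s) ℝ)
    (maa : Matrix (Fin m) (Fin m) ℝ) (ka ku : ℝ)
    (q qd : ℝ → (Fin s ⊕ Fin m) → ℝ) (t : ℝ) : Fin m → ℝ :=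
  ka • yA mau maa (q t ∘ Sum.inl) (qd t ∘ Sum.inl) (qd t ∘ Sum.inr)
    + ku • yU mau maa (q t ∘ Sum.inl) (qd t ∘ Sum.inl)

section Calculus

variable {ι κ : Type*} [Fintype ι] {S : Set ℝ} {t : ℝ}

theorem HasDerivWithinAt.dotProduct_vec {f g : ℝ → ι → ℝ} {df dg : ι → ℝ}
    (hf : HasDerivWithinAt f df S t) (hg : HasDerivWithinAt g dg S t) :
    HasDerivWithinAt (fun x => f x ⬝ᵥ g x) (df ⬝ᵥ g t + f t ⬝ᵥ dg) S t := by
  rw [hasDerivWithinAt_pi] at hf hg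
  simp only [dotProduct, ← Finset.sum_add_distrib]
  exact HasDerivWithinAt.fun_sum fun i _ => (hf i).mul (hg i)

theorem HasDerivWithinAt.mulVec_vec [Fintype κ] {A : ℝ → Matrix κ ι ℝ} {dA : Matrix κ ι ℝ}
    {f : ℝ → ι → ℝ} {df : ι → ℝ}
    (hA : ∀ i j, HasDerivWithinAt (fun x => A x i j) (dA i j) S t)
    (hf : HasDerivWithinAt f df S t) :
    HasDerivWithinAt (fun x => A x *ᵥ f x) (dA *ᵥ f t + A t *ᵥ df) S t := by
  rw [hasDerivWithinAt_pi]
  intro i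
  exact HasDerivWithinAt.dotProduct_vec (hasDerivWithinAt_pi.2 (hA i)) hf

theorem sum_apply_single_mul [DecidableEq ι] (L : (ι → ℝ) →L[ℝ] ℝ) (v : ι → ℝ) :
    ∑ j, L (Pi.single j 1) * v j = L v := by
  conv_rhs => rw [← Finset.univ_sum_single v, map_sum]
  refine Finset.sum_congr rfl fun j _ => ?_
  rw [mul_comm, ← smul_eq_mul, ← map_smul, ← Pi.single_smul, smul_eq_mul, mul_one]

end Calculus

section Algebra

variable {s m : ℕ} {muu : (Fin s → ℝ) → Matrix (Fin s) (Fin s) ℝ}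
  {mau : (Fin s → ℝ) → Matrix (Fin m) (Fin s) ℝ} {maa : Matrix (Fin m) (Fin m) ℝ}

theorem posDef_maa_of_Mblk {qu : Fin s → ℝ} (hM : (Mblk muu mau maa qu).PosDef) :
    maa.PosDef :=
  hM.submatrix (e := Sum.inr) Sum.inr_injective

/-- The momentum conjugate to the actuated coordinates. -/
def actuatedMomentum (mau : (Fin s → ℝ) → Matrix (Fin m) (Fin s) ℝ)
    (maa : Matrix (Fin m) (Fin m) ℝ) (qu : Fin s → ℝ) (v : Fin s ⊕ Fin m → ℝ) : Fin m → ℝ :=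
  mau qu *ᵥ (v ∘ Sum.inl) + maa *ᵥ (v ∘ Sum.inr)

theorem yA_eq_inv_mulVec_actuatedMomentum (hmaa : maa.PosDef) (qu : Fin s → ℝ)
    (v : Fin s ⊕ Fin m → ℝ) :
    yA mau maa qu (v ∘ Sum.inl) (v ∘ Sum.inr) = maa⁻¹ *ᵥ actuatedMomentum mau maa qu v := by
  simp [yA, actuatedMomentum, mulVec_add, Matrix.nonsing_inv_mul _ hmaa.det_pos.ne'.isUnit]

theorem Ha_eq_actuatedMomentum (hmaa : maa.PosDef) (qu : Fin s → ℝ)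
    (v : Fin s ⊕ Fin m → ℝ) :
    Ha mau maa qu v = (1 / 2 : ℝ) *
      (actuatedMomentum mau maa qu v ⬝ᵥ maa⁻¹ *ᵥ actuatedMomentum mau maa qu v) := by
  have hv : v = Sum.elim (v ∘ Sum.inl) (v ∘ Sum.inr) := (Sum.elim_comp_inl_inr v).symm
  have hsymm : maaᵀ = maa := by simpa using hmaa.isHermitian.eq
  have hcancel : maa⁻¹ *ᵥ (maa *ᵥ (v ∘ Sum.inr)) = v ∘ Sum.inr := by
    simp [Matrix.nonsing_inv_mul _ hmaa.det_pos.ne'.isUnit]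
  have hcancel_dot : ∀ w, (maa *ᵥ (v ∘ Sum.inr)) ⬝ᵥ (maa⁻¹ *ᵥ w) = (v ∘ Sum.inr) ⬝ᵥ w := by
    intro w
    rw [← vecMul_transpose, hsymm, ← dotProduct_mulVec, mulVec_mulVec,
      Matrix.mul_nonsing_inv _ hmaa.det_pos.ne'.isUnit, one_mulVec]
  have htr : ∀ w, (v ∘ Sum.inl) ⬝ᵥ ((mau qu)ᵀ *ᵥ w) = (mau qu *ᵥ (v ∘ Sum.inl)) ⬝ᵥ w := by
    intro w
    rw [dotProduct_mulVec, vecMul_transpose]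
  rw [Ha, MaMat, actuatedMomentum]
  conv_lhs => rw [hv]
  rw [fromBlocks_mulVec, sumElim_dotProduct_sumElim]
  simp only [Sum.elim_comp_inl, Sum.elim_comp_inr, mulVec_add, dotProduct_add, add_dotProduct,
    hcancel, hcancel_dot, ← mulVec_mulVec, htr]
  rw [dotProduct_comm (maa *ᵥ _)]
  ring

theorem Ha_nonneg (hmaa : maa.PosDef) (qu : Fin s → ℝ) (v : Fin s ⊕ Fin m → ℝ) :
    0 ≤ Ha mau maa qu v := by
  rw [Ha_eq_actuatedMomentum hmaa]
  have := hmaa.inv.posSemidef.dotProduct_mulVec_nonneg (actuatedMomentum mau maa qu v)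
  simp only [star_trivial] at this
  positivity

/-- The Schur-complement energy is the total energy minus the actuated part. -/
theorem Hu_eq_energy_sub_Ha (Vu : (Fin s → ℝ) → ℝ) (qu : Fin s → ℝ) (v : Fin s ⊕ Fin m → ℝ) :
    Hu muu mau maa Vu qu (v ∘ Sum.inl) =
      (1 / 2 : ℝ) * (v ⬝ᵥ Mblk muu mau maa qu *ᵥ v) + Vu qu - Ha mau maa qu v := by
  have hv : v = Sum.elim (v ∘ Sum.inl) (v ∘ Sum.inr) := (Sum.elim_comp_inl_inr v).symm
  rw [Hu, Ha, muuS, Mblk, MaMat]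
  generalize v ∘ Sum.inl = x at *
  generalize v ∘ Sum.inr = y at *
  subst hv
  simp only [fromBlocks_mulVec, sumElim_dotProduct_sumElim, Sum.elim_comp_inl,
    Sum.elim_comp_inr, sub_mulVec, dotProduct_sub, dotProduct_add]
  ring

theorem le_Hu (hmaa : maa.PosDef) {qu : Fin s → ℝ} (hM : (Mblk muu mau maa qu).PosDef)
    (Vu : (Fin s → ℝ) → ℝ) (vu : Fin s → ℝ) : Vu qu ≤ Hu muu mau maa Vu qu vu := by
  have hsplit := Hu_eq_energy_sub_Ha (muu := muu) (mau := mau) (maa := maa) Vu qu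
    (Sum.elim vu (-(maa⁻¹ *ᵥ (mau qu *ᵥ vu))))
  have hHa : Ha mau maa qu (Sum.elim vu (-(maa⁻¹ *ᵥ (mau qu *ᵥ vu)))) = 0 := by
    simp [Ha_eq_actuatedMomentum hmaa, actuatedMomentum, mulVec_neg, ← Matrix.mul_assoc,
      Matrix.mul_nonsing_inv _ hmaa.det_pos.ne'.isUnit]
  have hnonneg := hM.posSemidef.dotProduct_mulVec_nonneg
    (Sum.elim vu (-(maa⁻¹ *ᵥ (mau qu *ᵥ vu))))
  rw [star_trivial] at hnonneg
  rw [Sum.elim_comp_inl, hHa] at hsplit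
  linarith

end Algebra

section Dynamics

variable {s m : ℕ} {muu : (Fin s → ℝ) → Matrix (Fin s) (Fin s) ℝ}
  {mau : (Fin s → ℝ) → Matrix (Fin m) (Fin s) ℝ} {maa : Matrix (Fin m) (Fin m) ℝ}

theorem contDiff_Mblk_apply (hmuu : ∀ i j, ContDiff ℝ (⊤ : ℕ∞) fun x => muu x i j)
    (hmau : ∀ i j, ContDiff ℝ (⊤ : ℕ∞) fun x => mau x i j) (i j : Fin s ⊕ Fin m) :
    ContDiff ℝ (⊤ : ℕ∞) fun x => Mblk muu mau maa x i j := by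
  rcases i with i | i <;> rcases j with j | j
  · exact hmuu i j
  · exact hmau j i
  · exact hmau i j
  · exact contDiff_const

/-- Projection of a configuration to its unactuated coordinates. -/
def unactuatedProj (s m : ℕ) : (Fin s ⊕ Fin m → ℝ) →L[ℝ] (Fin s → ℝ) :=
  ContinuousLinearMap.pi fun i => ContinuousLinearMap.proj (Sum.inl i)

/-- The directional derivative of the inertia matrix along `v`. -/
def MblkDeriv (muu : (Fin s → ℝ) → Matrix (Fin s) (Fin s) ℝ)
    (mau : (Fin s → ℝ) → Matrix (Fin m) (Fin s) ℝ)
    (maa : Matrix (Fin m) (Fin m) ℝ) (q v : Fin s ⊕ Fin m → ℝ) :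
    Matrix (Fin s ⊕ Fin m) (Fin s ⊕ Fin m) ℝ :=
  fun i k => fderiv ℝ (fun x => Mblk muu mau maa x i k) (q ∘ Sum.inl) (v ∘ Sum.inl)

theorem hasFDerivAt_Mblk_mulVec
    (hmuu : ∀ i j, ContDiff ℝ (⊤ : ℕ∞) fun x => muu x i j)
    (hmau : ∀ i j, ContDiff ℝ (⊤ : ℕ∞) fun x => mau x i j)
    (q v : Fin s ⊕ Fin m → ℝ) (i : Fin s ⊕ Fin m) :
    HasFDerivAt (fun p : Fin s ⊕ Fin m → ℝ => (Mblk muu mau maa (p ∘ Sum.inl) *ᵥ v) i)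
      (∑ k, v k • (fderiv ℝ (fun x => Mblk muu mau maa x i k) (q ∘ Sum.inl)).comp
        (unactuatedProj s m)) q := by
  simp only [mulVec, dotProduct]
  refine HasFDerivAt.fun_sum fun k _ => ?_
  have hd : HasFDerivAt (fun x => Mblk muu mau maa x i k) _ (unactuatedProj s m q) :=
    ((contDiff_Mblk_apply hmuu hmau i k).differentiable (by simp) _).hasFDerivAt
  exact (hd.comp q (unactuatedProj s m).hasFDerivAt).mul_const (v k)

theorem Jmat_mulVec (hmuu : ∀ i j, ContDiff ℝ (⊤ : ℕ∞) fun x => muu x i j)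
    (hmau : ∀ i j, ContDiff ℝ (⊤ : ℕ∞) fun x => mau x i j) (q v : Fin s ⊕ Fin m → ℝ) :
    Jmat muu mau maa q v *ᵥ v = MblkDeriv muu mau maa q v *ᵥ v := by
  ext i
  refine (sum_apply_single_mul (fderiv ℝ (fun p : Fin s ⊕ Fin m → ℝ =>
    (Mblk muu mau maa (p ∘ Sum.inl) *ᵥ v) i) q) v).trans ?_
  rw [(hasFDerivAt_Mblk_mulVec hmuu hmau q v i).fderiv, _root_.sum_apply]
  exact Finset.sum_congr rfl fun k _ => mul_comm _ _

theorem Jmat_apply_inr (hmuu : ∀ i j, ContDiff ℝ (⊤ : ℕ∞) fun x => muu x i j)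
    (hmau : ∀ i j, ContDiff ℝ (⊤ : ℕ∞) fun x => mau x i j) (q v : Fin s ⊕ Fin m → ℝ)
    (i : Fin s ⊕ Fin m) (j : Fin m) : Jmat muu mau maa q v i (Sum.inr j) = 0 := by
  have hproj : unactuatedProj s m (Pi.single (Sum.inr j) 1) = 0 := by
    ext k
    simp [unactuatedProj]
  rw [Jmat, (hasFDerivAt_Mblk_mulVec hmuu hmau q v i).fderiv, _root_.sum_apply]
  simp [hproj]

theorem Cvec_inr (hmuu : ∀ i j, ContDiff ℝ (⊤ : ℕ∞) fun x => muu x i j)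
    (hmau : ∀ i j, ContDiff ℝ (⊤ : ℕ∞) fun x => mau x i j) (q v : Fin s ⊕ Fin m → ℝ)
    (j : Fin m) :
    Cvec muu mau maa q v (Sum.inr j) = (MblkDeriv muu mau maa q v *ᵥ v) (Sum.inr j) := by
  rw [Cvec, sub_mulVec, Jmat_mulVec hmuu hmau, smul_mulVec, Pi.sub_apply, Pi.smul_apply]
  simp [mulVec, dotProduct, Jmat_apply_inr hmuu hmau]

theorem dotProduct_Cvec (hmuu : ∀ i j, ContDiff ℝ (⊤ : ℕ∞) fun x => muu x i j)
    (hmau : ∀ i j, ContDiff ℝ (⊤ : ℕ∞) fun x => mau x i j) (q v : Fin s ⊕ Fin m → ℝ) :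
    v ⬝ᵥ Cvec muu mau maa q v = (1 / 2 : ℝ) * (v ⬝ᵥ MblkDeriv muu mau maa q v *ᵥ v) := by
  have htr : v ⬝ᵥ (Jmat muu mau maa q v)ᵀ *ᵥ v = v ⬝ᵥ MblkDeriv muu mau maa q v *ᵥ v := by
    rw [dotProduct_mulVec, vecMul_transpose, Jmat_mulVec hmuu hmau, dotProduct_comm]
  rw [Cvec, sub_mulVec, Jmat_mulVec hmuu hmau, smul_mulVec, dotProduct_sub, dotProduct_smul, htr,
    smul_eq_mul]
  ring

variable {S : Set ℝ} {t : ℝ} {q qd : ℝ → Fin s ⊕ Fin m → ℝ} {acc : Fin s ⊕ Fin m → ℝ}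

theorem hasDerivWithinAt_comp_inl (hq : HasDerivWithinAt q (qd t) S t) :
    HasDerivWithinAt (fun r => q r ∘ Sum.inl) (qd t ∘ Sum.inl) S t :=
  hasDerivWithinAt_pi.2 fun i => hasDerivWithinAt_pi.1 hq (Sum.inl i)

/-- Time derivative of the generalized momentum `M(q_u) q̇`. -/
theorem hasDerivWithinAt_momentum
    (hmuu : ∀ i j, ContDiff ℝ (⊤ : ℕ∞) fun x => muu x i j)
    (hmau : ∀ i j, ContDiff ℝ (⊤ : ℕ∞) fun x => mau x i j)
    (hq : HasDerivWithinAt q (qd t) S t) (hqd : HasDerivWithinAt qd acc S t) :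
    HasDerivWithinAt (fun r => Mblk muu mau maa (q r ∘ Sum.inl) *ᵥ qd r)
      (MblkDeriv muu mau maa (q t) (qd t) *ᵥ qd t + Mblk muu mau maa (q t ∘ Sum.inl) *ᵥ acc)
      S t := by
  refine HasDerivWithinAt.mulVec_vec (fun i j => ?_) hqd
  exact ((contDiff_Mblk_apply hmuu hmau i j).differentiable (by simp) _).hasFDerivAt
    |>.comp_hasDerivWithinAt t (hasDerivWithinAt_comp_inl hq)

theorem actuatedMomentum_eq_Mblk_mulVec (qu : Fin s → ℝ) (v : Fin s ⊕ Fin m → ℝ) (j : Fin m) :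
    actuatedMomentum mau maa qu v j = (Mblk muu mau maa qu *ᵥ v) (Sum.inr j) := by
  rw [Mblk, fromBlocks_mulVec]
  rfl

variable {Vu : (Fin s → ℝ) → ℝ} {Va : (Fin m → ℝ) → ℝ} {τ : Fin m → ℝ}

/-- The momentum conjugate to `q_a` is driven by `u = τ − ∇V_a` alone. -/
theorem hasDerivWithinAt_actuatedMomentum
    (hmuu : ∀ i j, ContDiff ℝ (⊤ : ℕ∞) fun x => muu x i j)
    (hmau : ∀ i j, ContDiff ℝ (⊤ : ℕ∞) fun x => mau x i j)
    (hq : HasDerivWithinAt q (qd t) S t) (hqd : HasDerivWithinAt qd acc S t)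
    (hEL : Mblk muu mau maa (q t ∘ Sum.inl) *ᵥ acc + Cvec muu mau maa (q t) (qd t)
      + Sum.elim (grad Vu (q t ∘ Sum.inl)) (grad Va (q t ∘ Sum.inr)) =
        Sum.elim (0 : Fin s → ℝ) τ) :
    HasDerivWithinAt (fun r => actuatedMomentum mau maa (q r ∘ Sum.inl) (qd r))
      (τ - grad Va (q t ∘ Sum.inr)) S t := by
  rw [hasDerivWithinAt_pi]
  intro j
  have hP := hasDerivWithinAt_pi.1 (hasDerivWithinAt_momentum (maa := maa) hmuu hmau hq hqd)
    (Sum.inr j)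
  have hj := congrFun hEL (Sum.inr j)
  simp only [Pi.add_apply, Sum.elim_inr, Cvec_inr hmuu hmau] at hj
  simp only [actuatedMomentum_eq_Mblk_mulVec (muu := muu)]
  convert hP using 1
  simp only [Pi.sub_apply, Pi.add_apply]
  linarith

theorem hasDerivWithinAt_Ha
    (hmuu : ∀ i j, ContDiff ℝ (⊤ : ℕ∞) fun x => muu x i j)
    (hmau : ∀ i j, ContDiff ℝ (⊤ : ℕ∞) fun x => mau x i j) (hmaa : maa.PosDef)
    (hq : HasDerivWithinAt q (qd t) S t) (hqd : HasDerivWithinAt qd acc S t)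
    (hEL : Mblk muu mau maa (q t ∘ Sum.inl) *ᵥ acc + Cvec muu mau maa (q t) (qd t)
      + Sum.elim (grad Vu (q t ∘ Sum.inl)) (grad Va (q t ∘ Sum.inr)) =
        Sum.elim (0 : Fin s → ℝ) τ) :
    HasDerivWithinAt (fun r => Ha mau maa (q r ∘ Sum.inl) (qd r))
      ((τ - grad Va (q t ∘ Sum.inr)) ⬝ᵥ
        yA mau maa (q t ∘ Sum.inl) (qd t ∘ Sum.inl) (qd t ∘ Sum.inr)) S t := by
  have hp := hasDerivWithinAt_actuatedMomentum hmuu hmau hq hqd hEL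
  have hinv : HasDerivWithinAt
      (fun r => maa⁻¹ *ᵥ actuatedMomentum mau maa (q r ∘ Sum.inl) (qd r)) _ S t :=
    HasDerivWithinAt.mulVec_vec (A := fun _ => maa⁻¹) (dA := 0)
      (fun _ _ => hasDerivWithinAt_const ..) hp
  simp only [Ha_eq_actuatedMomentum hmaa, yA_eq_inv_mulVec_actuatedMomentum hmaa]
  refine ((hp.dotProduct_vec hinv).const_mul (1 / 2 : ℝ)).congr_deriv ?_
  have hsymm : (maa⁻¹)ᵀ = maa⁻¹ := by simpa using hmaa.inv.isHermitian.eq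
  rw [zero_mulVec, zero_add, dotProduct_mulVec (actuatedMomentum _ _ _ _), ← mulVec_transpose,
    hsymm, dotProduct_comm (maa⁻¹ *ᵥ _)]
  ring

/-- Energy balance for the mechanical energy without the actuated potential. -/
theorem hasDerivWithinAt_energy
    (hmuu : ∀ i j, ContDiff ℝ (⊤ : ℕ∞) fun x => muu x i j)
    (hmau : ∀ i j, ContDiff ℝ (⊤ : ℕ∞) fun x => mau x i j)
    (hM : (Mblk muu mau maa (q t ∘ Sum.inl)).PosDef) (hVu : ContDiff ℝ (⊤ : ℕ∞) Vu)
    (hq : HasDerivWithinAt q (qd t) S t) (hqd : HasDerivWithinAt qd acc S t)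
    (hEL : Mblk muu mau maa (q t ∘ Sum.inl) *ᵥ acc + Cvec muu mau maa (q t) (qd t)
      + Sum.elim (grad Vu (q t ∘ Sum.inl)) (grad Va (q t ∘ Sum.inr)) =
        Sum.elim (0 : Fin s → ℝ) τ) :
    HasDerivWithinAt
      (fun r => (1 / 2 : ℝ) * (qd r ⬝ᵥ Mblk muu mau maa (q r ∘ Sum.inl) *ᵥ qd r)
        + Vu (q r ∘ Sum.inl))
      ((τ - grad Va (q t ∘ Sum.inr)) ⬝ᵥ (qd t ∘ Sum.inr)) S t := by
  have hV : HasDerivWithinAt (fun r => Vu (q r ∘ Sum.inl))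
      (grad Vu (q t ∘ Sum.inl) ⬝ᵥ (qd t ∘ Sum.inl)) S t := by
    refine ((hVu.differentiable (by simp) _).hasFDerivAt.comp_hasDerivWithinAt t
      (hasDerivWithinAt_comp_inl hq)).congr_deriv ?_
    exact (sum_apply_single_mul _ _).symm
  have hK := (hqd.dotProduct_vec
    (hasDerivWithinAt_momentum (maa := maa) hmuu hmau hq hqd)).const_mul (1 / 2 : ℝ)
  refine (hK.add hV).congr_deriv ?_
  have hsymm : (Mblk muu mau maa (q t ∘ Sum.inl))ᵀ = Mblk muu mau maa (q t ∘ Sum.inl) := by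
    simpa using hM.isHermitian.eq
  have hswap : acc ⬝ᵥ Mblk muu mau maa (q t ∘ Sum.inl) *ᵥ qd t =
      qd t ⬝ᵥ Mblk muu mau maa (q t ∘ Sum.inl) *ᵥ acc := by
    rw [dotProduct_mulVec, ← mulVec_transpose, hsymm, dotProduct_comm]
  have hpower := congrArg (fun w => qd t ⬝ᵥ w) hEL
  simp only [dotProduct_add, dotProduct_Cvec hmuu hmau] at hpower
  have helim : ∀ (x : Fin s → ℝ) (y : Fin m → ℝ), qd t ⬝ᵥ Sum.elim x y =
      x ⬝ᵥ (qd t ∘ Sum.inl) + y ⬝ᵥ (qd t ∘ Sum.inr) := by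
    intro x y
    rw [dotProduct_comm]
    conv_lhs => rw [← Sum.elim_comp_inl_inr (qd t)]
    exact sumElim_dotProduct_sumElim ..
  rw [helim, helim, zero_dotProduct] at hpower
  rw [dotProduct_add, hswap, sub_dotProduct]
  linarith

end Dynamics

section Continuity

variable {s m : ℕ} {mau : (Fin s → ℝ) → Matrix (Fin m) (Fin s) ℝ}
  {maa : Matrix (Fin m) (Fin m) ℝ} {q qd : ℝ → Fin s ⊕ Fin m → ℝ} {S : Set ℝ}

theorem continuous_grad {k : ℕ} {f : (Fin k → ℝ) → ℝ} (hf : ContDiff ℝ (⊤ : ℕ∞) f) :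
    Continuous (grad f) :=
  continuous_pi fun _ => (hf.continuous_fderiv (by simp)).clm_apply continuous_const

theorem continuousOn_comp_index {ι κ : Type*} (e : κ → ι) {f : ℝ → ι → ℝ}
    (hf : ContinuousOn f S) : ContinuousOn (fun r => f r ∘ e) S :=
  continuousOn_pi.2 fun i => continuousOn_pi.1 hf (e i)

theorem continuousOn_ydSig (hmau : ∀ i j, ContDiff ℝ (⊤ : ℕ∞) fun x => mau x i j) (ka ku : ℝ)
    (hq : ContinuousOn q S) (hqd : ContinuousOn qd S) :
    ContinuousOn (ydSig mau maa ka ku q qd) S := by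
  unfold ydSig yA yU
  generalize maa⁻¹ = W
  have hcont : Continuous fun z : (Fin s → ℝ) × (Fin s → ℝ) => W *ᵥ (mau z.1 *ᵥ z.2) :=
    continuous_const.matrix_mulVec (Continuous.matrix_mulVec
      (continuous_matrix fun i j => (hmau i j).continuous.comp continuous_fst) continuous_snd)
  have hy : ContinuousOn (fun r => W *ᵥ (mau (q r ∘ Sum.inl) *ᵥ (qd r ∘ Sum.inl))) S :=
    hcont.comp_continuousOn (f := fun r => (q r ∘ Sum.inl, qd r ∘ Sum.inl))
      ((continuousOn_comp_index Sum.inl hq).prodMk (continuousOn_comp_index Sum.inl hqd))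
  exact ((hy.add (continuousOn_comp_index Sum.inr hqd)).const_smul ka).add (hy.neg.const_smul ku)

end Continuity

/-- Lemma 1: if `k_e, k_a, k_u` have the same sign then
`H₁ = k_e(k_a H_a + k_u H_u)` is bounded below, `d/dt H₁ = k_e uᵀ y_d` along any trajectory
with inner-loop control `u = τ − ∇V_a(q_a)`, and the operator `k_e u ↦ y_d` is passive. -/
theorem lemma1_passivity
    {s m : ℕ} (hs : 1 ≤ s) (hm : 1 ≤ m)
    (muu : (Fin s → ℝ) → Matrix (Fin s) (Fin s) ℝ)
    (mau : (Fin s → ℝ) → Matrix (Fin m) (Fin s) ℝ)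
    (maa : Matrix (Fin m) (Fin m) ℝ)
    (hmuu : ∀ i j, ContDiff ℝ (⊤ : ℕ∞) fun x => muu x i j)
    (hmau : ∀ i j, ContDiff ℝ (⊤ : ℕ∞) fun x => mau x i j)
    (hmaa : maa.IsSymm)
    (hM : ∀ qu, (Mblk muu mau maa qu).PosDef)
    (Vu : (Fin s → ℝ) → ℝ) (Va : (Fin m → ℝ) → ℝ)
    (hVu : ContDiff ℝ (⊤ : ℕ∞) Vu) (hVa : ContDiff ℝ (⊤ : ℕ∞) Va)
    (hVubdd : ∃ c : ℝ, ∀ x, c ≤ Vu x)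
    (ke ka ku : ℝ) (hke : ke ≠ 0) (hka : ka ≠ 0) (hku : ku ≠ 0) (hkaku : ka ≠ ku)
    (hsign : (0 < ke ∧ 0 < ka ∧ 0 < ku) ∨ (ke < 0 ∧ ka < 0 ∧ ku < 0))
    (q qd qdd : ℝ → (Fin s ⊕ Fin m) → ℝ)
    (τ : ℝ → Fin m → ℝ) (hτ : ContinuousOn τ (Ici 0))
    (hq : ∀ t ∈ Ici (0:ℝ), HasDerivWithinAt q (qd t) (Ici 0) t)
    (hqd : ∀ t ∈ Ici (0:ℝ), HasDerivWithinAt qd (qdd t) (Ici 0) t)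
    (hqdd : ContinuousOn qdd (Ici 0))
    (hEL : ∀ t ∈ Ici (0:ℝ),
      Mblk muu mau maa (q t ∘ Sum.inl) *ᵥ qdd t
        + Cvec muu mau maa (q t) (qd t)
        + Sum.elim (grad Vu (q t ∘ Sum.inl)) (grad Va (q t ∘ Sum.inr))
      = Sum.elim (0 : Fin s → ℝ) (τ t))
 :
    (∃ c : ℝ, ∀ (qu : Fin s → ℝ) (qdot : (Fin s ⊕ Fin m) → ℝ),
        c ≤ ke * (ka * Ha mau maa qu qdot + ku * Hu muu mau maa Vu qu (qdot ∘ Sum.inl)))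
    ∧ (∀ t ∈ Ici (0:ℝ),
        HasDerivWithinAt
          (fun t => ke * (ka * Ha mau maa (q t ∘ Sum.inl) (qd t)
              + ku * Hu muu mau maa Vu (q t ∘ Sum.inl) (qd t ∘ Sum.inl)))
          (ke * ((τ t - grad Va (q t ∘ Sum.inr)) ⬝ᵥ ydSig mau maa ka ku q qd t))
          (Ici 0) t)
    ∧ ∃ β₁ : ℝ, ∀ t ∈ Ici (0:ℝ),
        β₁ ≤ ∫ σ in (0:ℝ)..t,
          ke * ((τ σ - grad Va (q σ ∘ Sum.inr)) ⬝ᵥ ydSig mau maa ka ku q qd σ) := by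
  have hmaa_pos : maa.PosDef := posDef_maa_of_Mblk (hM 0)
  have hkeka : 0 < ke * ka := by
    rcases hsign with ⟨h₁, h₂, -⟩ | ⟨h₁, h₂, -⟩
    exacts [mul_pos h₁ h₂, mul_pos_of_neg_of_neg h₁ h₂]
  have hkeku : 0 < ke * ku := by
    rcases hsign with ⟨h₁, -, h₂⟩ | ⟨h₁, -, h₂⟩
    exacts [mul_pos h₁ h₂, mul_pos_of_neg_of_neg h₁ h₂]
  have hbdd : ∃ c : ℝ, ∀ (qu : Fin s → ℝ) (qdot : (Fin s ⊕ Fin m) → ℝ),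
      c ≤ ke * (ka * Ha mau maa qu qdot + ku * Hu muu mau maa Vu qu (qdot ∘ Sum.inl)) := by
    obtain ⟨c, hc⟩ := hVubdd
    refine ⟨ke * ku * c, fun qu qdot => ?_⟩
    have ha := mul_nonneg hkeka.le (Ha_nonneg (mau := mau) hmaa_pos qu qdot)
    have hu := mul_le_mul_of_nonneg_left
      ((hc qu).trans (le_Hu hmaa_pos (hM qu) Vu (qdot ∘ Sum.inl))) hkeku.le
    linarith
  have hderiv : ∀ t ∈ Ici (0:ℝ), HasDerivWithinAt
      (fun t => ke * (ka * Ha mau maa (q t ∘ Sum.inl) (qd t)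
        + ku * Hu muu mau maa Vu (q t ∘ Sum.inl) (qd t ∘ Sum.inl)))
      (ke * ((τ t - grad Va (q t ∘ Sum.inr)) ⬝ᵥ ydSig mau maa ka ku q qd t)) (Ici 0) t := by
    intro t ht
    have hHa := hasDerivWithinAt_Ha hmuu hmau hmaa_pos (hq t ht) (hqd t ht) (hEL t ht)
    have hE := hasDerivWithinAt_energy hmuu hmau (hM _) hVu (hq t ht) (hqd t ht) (hEL t ht)
    simp only [Hu_eq_energy_sub_Ha]
    refine (((hHa.const_mul ka).add ((hE.sub hHa).const_mul ku)).const_mul ke).congr_deriv ?_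
    simp only [ydSig, yA, yU, dotProduct_add, dotProduct_smul, dotProduct_neg, smul_eq_mul]
    ring
  refine ⟨hbdd, hderiv, ?_⟩
  obtain ⟨c, hc⟩ := hbdd
  refine ⟨c - ke * (ka * Ha mau maa (q 0 ∘ Sum.inl) (qd 0)
    + ku * Hu muu mau maa Vu (q 0 ∘ Sum.inl) (qd 0 ∘ Sum.inl)), fun t ht => ?_⟩
  have hqc : ContinuousOn q (Ici 0) := fun r hr => (hq r hr).continuousWithinAt
  have hqdc : ContinuousOn qd (Ici 0) := fun r hr => (hqd r hr).continuousWithinAt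
  have hcont : ContinuousOn (fun σ => ke * ((τ σ - grad Va (q σ ∘ Sum.inr)) ⬝ᵥ
      ydSig mau maa ka ku q qd σ)) (Ici 0) := by
    have hu : ContinuousOn (fun σ => τ σ - grad Va (q σ ∘ Sum.inr)) (Ici 0) :=
      hτ.sub ((continuous_grad hVa).comp_continuousOn (continuousOn_comp_index Sum.inr hqc))
    have hdot : Continuous fun z : (Fin m → ℝ) × (Fin m → ℝ) => z.1 ⬝ᵥ z.2 :=
      continuous_fst.dotProduct continuous_snd
    exact continuousOn_const.mul
      (hdot.comp_continuousOn (hu.prodMk (continuousOn_ydSig hmau ka ku hqc hqdc)))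
  rw [intervalIntegral.integral_eq_sub_of_hasDeriv_right_of_le ht
    (fun r hr => (hderiv r hr.1).continuousWithinAt.mono Icc_subset_Ici_self)
    (fun r hr => (hderiv r hr.1.le).mono fun x hx => (hr.1.trans hx).le)
    ((hcont.mono Icc_subset_Ici_self).intervalIntegrable_of_Icc ht)]
  exact sub_le_sub_right (hc _ _) _
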